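/- Fix Δ ∈ ℕ. There is a constant c(Δ) depending only on Δ such that the following holds. Let A ∈ ℤ^{m×n} be strictly Δ-modular with rank(A) = n, let b ∈ ℤ^m lie in the real column span of A, and suppose there is a directed graph with finite node set V and node-arc incidence matrix D ∈ {0,±1}^{V×m} (columns indexed by the rows of A) such that { y ∈ ℝ^m : D y = 0 } equals the real column span of A. Then conv(P(A,b) ∩ ℤ^n) admits an extended formulation of size at most c(Δ)·m·|V|^{Δ−1}. -/

import Mathlib

open Matrix

/-- `P(A,b) = {x ∈ ℝⁿ : A x ≤ b}`. -/
noncomputable def Pset {m n : ℕ} (A : Matrix (Fin m) (Fin n) ℤ) (b : Fin m → ℤ) :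
    Set (Fin n → ℝ) :=
  {x | (A.map (Int.cast : ℤ → ℝ)).mulVec x ≤ fun i => (b i : ℝ)}

/-- A real vector is integral if every entry is an integer. -/
def IsIntVec {n : ℕ} (x : Fin n → ℝ) : Prop := ∀ i, ∃ z : ℤ, x i = (z : ℝ)

/-- `E ⊆ ℝ^ι` admits an extended formulation of size `ℓ`. -/
def HasEF {ι : Type*} [Fintype ι] (E : Set (ι → ℝ)) (ℓ : ℕ) : Prop :=
  ∃ (k : ℕ) (B : Matrix (Fin ℓ) ι ℝ) (C : Matrix (Fin ℓ) (Fin k) ℝ) (d : Fin ℓ → ℝ),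
    E = {x | ∃ y : Fin k → ℝ, B.mulVec x + C.mulVec y ≤ d}

/-- Circulations on a finite digraph. -/
def Circ {N E R : Type*} [Fintype E] [DecidableEq N] [CommRing R] (s t : E → N) (f : E → R) : Prop :=
  ∀ w, ∑ e, f e * ((if w = s e then 1 else 0) - (if w = t e then 1 else 0)) = 0

section circ
variable {N E R : Type*} [Fintype E] [DecidableEq N] [CommRing R] {s t : E → N}

lemma Circ.pot [Fintype N] {M : Type*} [AddCommGroup M] [Module R M] {f : E → R}
    (hf : Circ s t f) (φ : N → M) : ∑ e, f e • (φ (s e) - φ (t e)) = 0 := by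
  have h : ∀ w, (∑ e, f e * ((if w = s e then 1 else 0) - (if w = t e then 1 else 0))) • φ w = 0 := by
    intro w; rw [hf w, zero_smul]
  have h2 := Finset.sum_congr (s₁ := (Finset.univ : Finset N)) rfl (fun w _ => h w)
  simp only [Finset.sum_smul, Finset.sum_const_zero] at h2
  rw [Finset.sum_comm] at h2
  rw [← h2]
  refine Finset.sum_congr rfl fun e _ => ?_
  simp only [mul_smul, ← Finset.smul_sum, sub_smul, ite_smul, one_smul, zero_smul,
    Finset.sum_sub_distrib, Finset.sum_ite_eq', Finset.mem_univ, if_true]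

lemma Circ.add {f g : E → R} (hf : Circ s t f) (hg : Circ s t g) : Circ s t (f + g) := by
  intro w
  simp only [Pi.add_apply, add_mul, Finset.sum_add_distrib, hf w, hg w, add_zero]

lemma Circ.smul {f : E → R} (c : R) (hf : Circ s t f) : Circ s t (c • f) := by
  intro w
  simp only [Pi.smul_apply, smul_eq_mul, mul_assoc, ← Finset.mul_sum, hf w, mul_zero]

lemma Circ.sub {f g : E → R} (hf : Circ s t f) (hg : Circ s t g) : Circ s t (f - g) := by
  intro w
  simp only [Pi.sub_apply, sub_mul, Finset.sum_sub_distrib, hf w, hg w, sub_zero]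

lemma Circ.zero : Circ s t (0 : E → R) := by
  intro w; simp

lemma Circ.sum {ι : Type*} (S : Finset ι) {f : ι → E → R} (h : ∀ i ∈ S, Circ s t (f i)) :
    Circ s t (∑ i ∈ S, f i) := by
  classical
  induction S using Finset.induction_on with
  | empty => simpa using Circ.zero
  | insert a S ha ih =>
    rw [Finset.sum_insert ha]
    exact (h a (by simp)).add (ih fun i hi => h i (by simp [hi]))

lemma circ_cast {f : E → ℤ} : Circ s t (fun e => (f e : ℝ)) ↔ Circ s t f := by
  unfold Circ
  refine forall_congr' fun w => ?_
  rw [← Int.cast_inj (α := ℝ)]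
  push_cast
  rfl

/-- Closed walk data. -/
structure CW (s t : E → N) (a : ℕ → E) (k : ℕ) : Prop where
  step : ∀ l, t (a l) = s (a (l + 1))
  close : s (a k) = s (a 0)

/-- characteristic vector -/
def cvec [DecidableEq E] (R : Type*) [CommRing R] (a : ℕ → E) (k : ℕ) : E → R :=
  fun e => ∑ l ∈ Finset.range k, if a l = e then 1 else 0

lemma CW.circ [DecidableEq E] {a : ℕ → E} {k : ℕ} (h : CW s t a k) : Circ s t (cvec R a k) := by
  intro w
  simp only [cvec, Finset.sum_mul]
  rw [Finset.sum_comm]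
  simp only [ite_mul, one_mul, zero_mul, Finset.sum_ite_eq, Finset.mem_univ, if_true]
  simp only [h.step]
  rw [Finset.sum_range_sub' (fun l => if w = s (a l) then (1 : R) else 0), h.close, sub_self]

lemma cvec_cast [DecidableEq E] (a : ℕ → E) (k : ℕ) (e : E) :
    ((cvec ℤ a k e : ℤ) : ℝ) = cvec ℝ a k e := by
  simp [cvec]

lemma cvec_nonneg [DecidableEq E] (a : ℕ → E) (k : ℕ) (e : E) : 0 ≤ cvec ℤ a k e := by
  unfold cvec; exact Finset.sum_nonneg fun _ _ => by split_ifs <;> norm_num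

lemma cvec_inj [DecidableEq E] {a : ℕ → E} {k : ℕ} (h : Set.InjOn a (Set.Iio k)) (e : E) :
    (cvec R a k e = 0 ∧ ∀ l < k, a l ≠ e) ∨ (cvec R a k e = 1 ∧ ∃ l < k, a l = e) := by
  by_cases hx : ∃ l < k, a l = e
  · right
    refine ⟨?_, hx⟩
    obtain ⟨l, hl, rfl⟩ := hx
    unfold cvec
    rw [Finset.sum_eq_single l]
    · simp
    · intro b hb hne
      rw [if_neg]
      intro heq
      exact hne (h (by simpa using hb) hl heq)
    · intro h; simp at h; omega
  · left
    push Not at hx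
    refine ⟨?_, hx⟩
    unfold cvec
    exact Finset.sum_eq_zero fun l hl => if_neg (hx l (by simpa using hl))

lemma exists_cycle {f : E → ℝ} (hf : Circ s t f) (h0 : ∀ e, 0 ≤ f e) (e0 : E) (he0 : 0 < f e0) :
    ∃ (a : ℕ → E) (k : ℕ), 0 < k ∧ CW s t a k ∧ Set.InjOn a (Set.Iio k) ∧ ∀ l, 0 < f (a l) := by
  have hnext : ∀ e : {e // 0 < f e}, ∃ e' : {e // 0 < f e}, s e'.1 = t e.1 := by
    rintro ⟨e, he⟩
    by_contra hcon
    push Not at hcon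
    have := hf (t e)
    simp only [mul_sub, Finset.sum_sub_distrib, sub_eq_zero] at this
    have h1 : ∑ e', f e' * (if t e = s e' then (1 : ℝ) else 0) = 0 := by
      refine Finset.sum_eq_zero fun e' _ => ?_
      by_cases h : t e = s e'
      · have : ¬ 0 < f e' := fun hp => hcon ⟨e', hp⟩ h.symm
        have : f e' = 0 := le_antisymm (not_lt.1 this) (h0 e')
        simp [this]
      · simp [h]
    have h2 : f e * (if t e = t e then (1 : ℝ) else 0) ≤
        ∑ e', f e' * (if t e = t e' then (1 : ℝ) else 0) :=
      Finset.single_le_sum (f := fun e' => f e' * (if t e = t e' then (1 : ℝ) else 0))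
        (fun e' _ => mul_nonneg (h0 e') (by split_ifs <;> norm_num)) (Finset.mem_univ e)
    simp only [if_true, mul_one] at h2
    linarith
  choose next hn using hnext
  obtain ⟨i, j, hij, heq⟩ := Finite.exists_ne_map_eq_of_infinite (fun n : ℕ => next^[n] ⟨e0, he0⟩)
  wlog hlt : i < j generalizing i j
  · exact this j i hij.symm heq.symm (by omega)
  set p := next^[i] ⟨e0, he0⟩ with hp
  have hper : Function.IsPeriodicPt next (j - i) p := by
    unfold Function.IsPeriodicPt Function.IsFixedPt
    rw [hp, ← Function.iterate_add_apply]
    have : j - i + i = j := by omega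
    rw [this]; exact heq.symm
  have hk : 0 < Function.minimalPeriod next p := hper.minimalPeriod_pos (by omega)
  refine ⟨fun l => (next^[l] p).1, Function.minimalPeriod next p, hk, ⟨?_, ?_⟩, ?_, fun l => (next^[l] p).2⟩
  · intro l
    simp only [Function.iterate_succ_apply']
    exact (hn _).symm
  · simp [Function.iterate_minimalPeriod]
  · intro x hx y hy hxy
    exact Function.iterate_injOn_Iio_minimalPeriod hx hy (Subtype.ext hxy)

/-- decomposition of real circulations -/
lemma real_decomp [DecidableEq E] (P : (E → ℝ) → Prop) (hP0 : P 0)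
    (hstep : ∀ (f : E → ℝ) (c : E → ℤ) (μ : ℝ), P f → 0 ≤ μ → Circ s t c →
      (∀ e, c e = 0 ∨ c e = 1) → P (f + μ • fun e => (c e : ℝ))) :
    ∀ f : E → ℝ, Circ s t f → (∀ e, 0 ≤ f e) → P f := by
  suffices ∀ (n : ℕ) (f : E → ℝ), (Finset.univ.filter fun e => 0 < f e).card = n →
      Circ s t f → (∀ e, 0 ≤ f e) → P f from fun f => this _ f rfl
  intro n
  induction n using Nat.strong_induction_on with
  | _ n ih =>
  intro f hn hf h0
  by_cases hz : ∃ e, 0 < f e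
  · obtain ⟨e0, he0⟩ := hz
    obtain ⟨a, k, hk, hcw, hinj, hpos⟩ := exists_cycle hf h0 e0 he0
    obtain ⟨l0, hl0, hmin⟩ := Finset.exists_min_image (Finset.range k) (fun l => f (a l)) ⟨0, by simpa using hk⟩
    simp only [Finset.mem_range] at hl0 hmin
    set μ := f (a l0)
    set g : E → ℝ := f - μ • cvec ℝ a k with hg
    have hgval : ∀ e, (g e = f e ∧ ∀ l < k, a l ≠ e) ∨ (g e = f e - μ ∧ ∃ l < k, a l = e) := by
      intro e
      rcases cvec_inj (R := ℝ) hinj e with h | h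
      · left; exact ⟨by simp [hg, h.1], h.2⟩
      · right; exact ⟨by simp [hg, h.1], h.2⟩
    have hgn : ∀ e, 0 ≤ g e := by
      intro e
      rcases hgval e with h | h
      · rw [h.1]; exact h0 e
      · obtain ⟨h1, l, hl, rfl⟩ := h
        rw [h1]; linarith [hmin l hl]
    have hPg : P g := by
      refine ih _ ?_ g rfl (hf.sub (hcw.circ.smul μ)) hgn
      rw [← hn]
      refine Finset.card_lt_card ((Finset.ssubset_iff_of_subset ?_).2 ⟨a l0, ?_, ?_⟩)
      · intro e
        simp only [Finset.mem_filter, Finset.mem_univ, true_and]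
        intro he
        rcases hgval e with h | h
        · rwa [h.1] at he
        · have := hpos l0; rw [h.1] at he; linarith
      · simpa using hpos l0
      · simp only [Finset.mem_filter, Finset.mem_univ, true_and, not_lt]
        rcases hgval (a l0) with h | h
        · exact absurd rfl (h.2 l0 hl0)
        · rw [h.1]; simp [μ]
    have := hstep g (cvec ℤ a k) μ hPg (hpos l0).le hcw.circ (fun e => (cvec_inj hinj e).imp And.left And.left)
    convert this using 1
    ext e
    simp [hg, cvec_cast]
  · have : f = 0 := by
      ext e; exact le_antisymm (not_lt.1 fun h => hz ⟨e, h⟩) (h0 e)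
    rw [this]; exact hP0

/-- decomposition of integer circulations into closed walks -/
lemma int_decomp [DecidableEq E] :
    ∀ f : E → ℤ, Circ s t f → (∀ e, 0 ≤ f e) →
      ∃ (n : ℕ) (c : Fin n → E → ℤ), (∀ i, ∃ a k, CW s t a k ∧ c i = cvec ℤ a k) ∧ ∑ i, c i = f := by
  suffices ∀ (N : ℕ) (f : E → ℤ), (∑ e, f e).toNat = N →
      Circ s t f → (∀ e, 0 ≤ f e) → ∃ (n : ℕ) (c : Fin n → E → ℤ),
        (∀ i, ∃ a k, CW s t a k ∧ c i = cvec ℤ a k) ∧ ∑ i, c i = f from fun f => this _ f rfl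
  intro N
  induction N using Nat.strong_induction_on with
  | _ N ih =>
  intro f hN hf h0
  by_cases hz : ∃ e, 0 < f e
  · obtain ⟨e0, he0⟩ := hz
    obtain ⟨a, k, hk, hcw, hinj, hpos⟩ := exists_cycle (circ_cast.2 hf)
      (fun e => by exact_mod_cast h0 e) e0 (by exact_mod_cast he0)
    have hpos' : ∀ l, 0 < f (a l) := fun l => by exact_mod_cast hpos l
    have hgn : ∀ e, 0 ≤ (f - cvec ℤ a k) e := by
      intro e
      rcases cvec_inj (R := ℤ) hinj e with h | h
      · simp [h.1, h0 e]
      · obtain ⟨h1, l, hl, rfl⟩ := h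
        have := hpos' l
        simp only [Pi.sub_apply, h1]; omega
    have hlt : ∑ e, (f - cvec ℤ a k) e < ∑ e, f e := by
      refine Finset.sum_lt_sum (fun e _ => ?_) ⟨a 0, Finset.mem_univ _, ?_⟩
      · simpa using cvec_nonneg a k e
      · rcases cvec_inj (R := ℤ) hinj (a 0) with h | h
        · exact absurd rfl (h.2 0 hk)
        · simp [h.1]
    have hnn : 0 ≤ ∑ e, (f - cvec ℤ a k) e := Finset.sum_nonneg fun e _ => hgn e
    obtain ⟨n, c, hc, hsum⟩ := ih _ (by omega) (f - cvec ℤ a k) rfl (hf.sub hcw.circ) hgn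
    refine ⟨n + 1, Fin.cons (cvec ℤ a k) c, ?_, ?_⟩
    · intro i
      refine Fin.cases ⟨a, k, hcw, rfl⟩ (fun i => ?_) i
      simpa using hc i
    · rw [Fin.sum_univ_succ]; simp [hsum]
  · refine ⟨0, Fin.elim0, fun i => i.elim0, ?_⟩
    ext e; simp; exact le_antisymm (h0 e) (not_lt.1 fun h => hz ⟨e, h⟩)
end circ
section lift
variable {V E G R : Type*} [Fintype E] [DecidableEq E] [Fintype V] [DecidableEq V]
  [AddCommGroup G] [Fintype G] [DecidableEq G] [CommRing R]

/-- tails in the lifted network -/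
def lsrc (s : E → V) (v : V) (h : G) : Option (E × G) → V × G
  | none => (v, h)
  | some p => (s p.1, p.2)

/-- heads in the lifted network -/
def ltgt (t : E → V) (γ : E → G) (v : V) : Option (E × G) → V × G
  | none => (v, 0)
  | some p => (t p.1, p.2 + γ p.1)

/-- projection of lifted flows -/
def lproj (F : Option (E × G) → R) : E → R := fun e => ∑ k, F (some (e, k))

variable {s t : E → V} {γ : E → G} {v : V} {h : G}

lemma lproj_add (F F' : Option (E × G) → R) : lproj (F + F') = lproj F + lproj F' := by
  ext e; simp [lproj, Finset.sum_add_distrib]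

lemma lproj_smul (c : R) (F : Option (E × G) → R) : lproj (c • F) = c • lproj F := by
  ext e; simp [lproj, Finset.mul_sum]

lemma circ_lift_iff {F : Option (E × G) → R} : Circ (lsrc s v h) (ltgt t γ v) F ↔
    ∀ w : V × G, F none * ((if w = (v, h) then 1 else 0) - (if w = (v, 0) then 1 else 0)) +
      ∑ p : E × G, F (some p) * ((if w = (s p.1, p.2) then 1 else 0) -
        (if w = (t p.1, p.2 + γ p.1) then 1 else 0)) = 0 := by
  unfold Circ
  refine forall_congr' fun w => ?_
  rw [Fintype.sum_option]
  exact Iff.rfl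

lemma lproj_circ {F : Option (E × G) → R} (hF : Circ (lsrc s v h) (ltgt t γ v) F) :
    Circ s t (lproj F) := by
  intro w
  have := hF.pot (fun p : V × G => if w = p.1 then (1 : R) else 0)
  rw [Fintype.sum_option] at this
  replace this : F none * ((if w = v then 1 else 0) - (if w = v then 1 else 0)) +
      ∑ p : E × G, F (some p) * ((if w = s p.1 then 1 else 0) - (if w = t p.1 then 1 else 0)) = 0 :=
    this
  rw [sub_self, mul_zero, zero_add, Fintype.sum_prod_type] at this
  simpa only [lproj, Finset.sum_mul] using this

lemma lproj_label {F : Option (E × G) → ℤ} (hF : Circ (lsrc s v h) (ltgt t γ v) F) :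
    ∑ e, lproj F e • γ e = F none • h := by
  have := hF.pot (fun p : V × G => p.2)
  simp only [Fintype.sum_option, lsrc, ltgt, sub_zero, Fintype.sum_prod_type,
    sub_add_cancel_left, smul_neg, Finset.sum_neg_distrib] at this
  simp only [lproj, Finset.sum_smul]
  exact (eq_of_sub_eq_zero (by rw [sub_eq_add_neg]; exact this)).symm

/-- c is the projection of a unit flow with label h -/
def Liftable (s t : E → V) (γ : E → G) (c : E → ℤ) (h : G) : Prop :=
  ∃ (v : V) (F : Option (E × G) → ℤ), (∀ o, 0 ≤ F o) ∧ F none = 1 ∧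
    Circ (lsrc s v h) (ltgt t γ v) F ∧ lproj F = c

lemma Liftable.zero [Nonempty V] : Liftable s t γ 0 0 := by
  obtain ⟨v⟩ := ‹Nonempty V›
  refine ⟨v, fun o => o.elim 1 (fun _ => 0), ?_, rfl, ?_, ?_⟩
  · rintro (_ | o) <;> simp
  · rw [circ_lift_iff]
    intro w
    simp
  · ext e; simp [lproj]

lemma Liftable.of_cw {a : ℕ → E} {k : ℕ} (hc : CW s t a k) :
    ∃ h, Liftable s t γ (cvec ℤ a k) h := by
  set H : ℕ → G := fun l => ∑ j ∈ Finset.range l, γ (a j) with hH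
  refine ⟨H k, s (a 0), fun o => o.elim 1 (cvec ℤ (fun l => (a l, H l)) k), ?_, rfl, ?_, ?_⟩
  · rintro (_ | o)
    · simp
    · exact cvec_nonneg _ _ _
  · rw [circ_lift_iff]
    intro w
    simp only [Option.elim, cvec, Finset.sum_mul]
    rw [Finset.sum_comm]
    simp only [ite_mul, one_mul, zero_mul, Finset.sum_ite_eq, Finset.mem_univ, if_true]
    have hs : ∀ l, (t (a l), H l + γ (a l)) = (s (a (l + 1)), H (l + 1)) := by
      intro l; rw [hc.step, hH]; simp [Finset.sum_range_succ]
    simp only [hs]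
    rw [Finset.sum_range_sub' (fun l => if w = (s (a l), H l) then (1 : ℤ) else 0), hc.close]
    simp [hH]
  · ext e
    simp only [lproj, cvec, Option.elim, Prod.mk.injEq]
    rw [Finset.sum_comm]
    refine Finset.sum_congr rfl fun l _ => ?_
    by_cases h : a l = e <;> simp [h]

lemma Liftable.nonneg {c : E → ℤ} (hc : Liftable s t γ c h) (e : E) : 0 ≤ c e := by
  obtain ⟨v, F, h0, _, _, rfl⟩ := hc
  exact Finset.sum_nonneg fun _ _ => h0 _

lemma Liftable.circ {c : E → ℤ} (hc : Liftable s t γ c h) : Circ s t c := by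
  obtain ⟨v, F, h0, _, h, rfl⟩ := hc
  exact lproj_circ h

lemma Liftable.label {c : E → ℤ} (hc : Liftable s t γ c h) : ∑ e, c e • γ e = h := by
  obtain ⟨v, F, h0, h1, h, rfl⟩ := hc
  rw [lproj_label h, h1, one_smul]

/-- zero-sum subsets -/
lemma zero_sum {N : ℕ} (hN : Fintype.card G ≤ N) (x : Fin N → G) :
    ∃ S : Finset (Fin N), S.Nonempty ∧ ∑ i ∈ S, x i = 0 := by
  let y : ℕ → G := fun i => if hi : i < N then x ⟨i, hi⟩ else 0
  let p : Fin (N + 1) → G := fun i => ∑ j ∈ Finset.range i, y j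
  obtain ⟨i, j, hij, heq⟩ := Fintype.exists_ne_map_eq_of_card_lt p (by simp; omega)
  wlog hlt : i < j generalizing i j
  · exact this j i hij.symm heq.symm (lt_of_le_of_ne (not_lt.1 hlt) hij.symm)
  refine ⟨Finset.univ.filter fun l : Fin N => i.1 ≤ l.1 ∧ l.1 < j.1, ⟨⟨i.1, by omega⟩, ?_⟩, ?_⟩
  · simpa using hlt
  · have h1 : ∑ l ∈ Finset.Ico i.1 j.1, y l = 0 := by
      rw [Finset.sum_Ico_eq_sub _ (le_of_lt hlt)]
      exact sub_eq_zero.2 heq.symm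
    rw [← h1]
    refine Finset.sum_bij (fun l _ => l.1) ?_ ?_ ?_ ?_
    · intro l hl; simpa using hl
    · intro a _ b _ hab; exact Fin.ext hab
    · intro l hl
      simp only [Finset.mem_Ico] at hl
      exact ⟨⟨l, by omega⟩, by simpa using hl, rfl⟩
    · intro l _; simp [y]

lemma good_all [Nonempty V] {d : ℕ} (hd : Fintype.card G ≤ d + 1) {z : E → ℤ} (hz : Circ s t z)
    (h0 : ∀ e, 0 ≤ z e) :
    ∃ (c : Fin d → E → ℤ) (h : Fin d → G), (∀ i, Liftable s t γ (c i) (h i)) ∧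
      (∀ e, ∑ i, c i e ≤ z e) ∧ ∑ i, h i = ∑ e, z e • γ e := by
  set Good : ℕ → Prop := fun N => ∃ (c : Fin N → E → ℤ) (h : Fin N → G),
    (∀ i, Liftable s t γ (c i) (h i)) ∧
      (∀ e, ∑ i, c i e ≤ z e) ∧ ∑ i, h i = ∑ e, z e • γ e with hGood
  have hex : ∃ N, Good N := by
    obtain ⟨n, c, hc, hsum⟩ := int_decomp z hz h0
    have : ∀ i, ∃ h, Liftable s t γ (c i) h := by
      intro i
      obtain ⟨a, k, hcw, he⟩ := hc i
      rw [he]; exact Liftable.of_cw hcw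
    choose h hh using this
    refine ⟨n, c, h, hh, ?_, ?_⟩
    · intro e; rw [← hsum]; simp
    · rw [← hsum]
      simp only [Finset.sum_apply, Finset.sum_smul]
      rw [Finset.sum_comm]
      exact Finset.sum_congr rfl fun i _ => (hh i).label.symm
  have hup : ∀ N, Good N → Good (N + 1) := by
    rintro N ⟨c, h, h1, h2, h3⟩
    refine ⟨Fin.cons 0 c, Fin.cons 0 h, ?_, ?_, ?_⟩
    · intro i
      refine Fin.cases ?_ (fun i => ?_) i
      · simpa using Liftable.zero
      · simpa using h1 i
    · intro e; rw [Fin.sum_univ_succ]; simpa using h2 e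
    · rw [Fin.sum_univ_succ]; simpa using h3
  have hdown : ∀ N, d ≤ N → Good (N + 1) → Good N := by
    rintro N hN ⟨c, h, h1, h2, h3⟩
    obtain ⟨S, ⟨p, hp⟩, hS⟩ := zero_sum (N := N + 1) (by omega) h
    set c' : Fin (N + 1) → E → ℤ := fun i => if i ∈ S then 0 else c i with hc'
    set h' : Fin (N + 1) → G := fun i => if i ∈ S then 0 else h i with hh'
    refine ⟨fun i => c' (p.succAbove i), fun i => h' (p.succAbove i), ?_, ?_, ?_⟩
    · intro i
      simp only [hc', hh']
      split_ifs
      · exact Liftable.zero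
      · exact h1 _
    · intro e
      have e1 := Fin.sum_univ_succAbove (fun i => c' i e) p
      have e2 : c' p e = 0 := by simp [hc', hp]
      rw [e2, zero_add] at e1
      rw [← e1]
      refine le_trans (Finset.sum_le_sum fun i _ => ?_) (h2 e)
      simp only [hc']
      split_ifs
      · exact (h1 i).nonneg e
      · exact le_rfl
    · have e1 := Fin.sum_univ_succAbove h' p
      have e2 : h' p = 0 := by simp [hh', hp]
      rw [e2, zero_add] at e1
      rw [← e1, ← h3]
      have e3 : ∀ i, h i = h' i + if i ∈ S then h i else 0 := by
        intro i; simp only [hh']; split_ifs <;> simp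
      rw [Finset.sum_congr rfl fun i _ => e3 i, Finset.sum_add_distrib]
      simp [hS]
  obtain ⟨N, hN⟩ := hex
  rcases le_total d N with hle | hle
  · exact Nat.decreasingInduction' (P := Good) (fun k _ hk hg => hdown k hk hg) hle hN
  · exact Nat.le_induction hN (fun k _ hg => hup k hg) d hle

/-- nonnegative integer circulations with label h -/
def Qy (s t : E → V) (γ : E → G) (h : G) : Set (E → ℝ) :=
  {y | ∃ z : E → ℤ, y = (fun e => (z e : ℝ)) ∧ (∀ e, 0 ≤ z e) ∧ Circ s t z ∧ ∑ e, z e • γ e = h}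

lemma conv_add_ray {q c : E → ℝ} (hq : q ∈ convexHull ℝ (Qy s t γ h)) {z : E → ℤ}
    (hc : c = fun e => (z e : ℝ)) (hz : Circ s t z) (h0 : ∀ e, 0 ≤ z e) {μ : ℝ} (hμ : 0 ≤ μ) :
    q + μ • c ∈ convexHull ℝ (Qy s t γ h) := by
  have hconv : Convex ℝ ((fun x => x + μ • c) ⁻¹' convexHull ℝ (Qy s t γ h)) :=
    (convex_convexHull ℝ _).translate_preimage_left (μ • c)
  refine convexHull_min ?_ hconv hq
  intro x hx
  simp only [Set.mem_preimage]
  obtain ⟨N, hN⟩ := exists_nat_gt μ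
  set n := Fintype.card G
  have hn : 0 < n := Fintype.card_pos
  have hNpos : (0 : ℝ) < N * n := by
    have : (0 : ℝ) < N := lt_of_le_of_lt hμ hN
    positivity
  have hx2 : x + (N * n : ℝ) • c ∈ Qy s t γ h := by
    obtain ⟨w, rfl, hw0, hw, hl⟩ := hx
    refine ⟨w + (N * n : ℤ) • z, ?_, ?_, hw.add (hz.smul _), ?_⟩
    · ext e; simp [hc]
    · intro e
      have := hw0 e
      have := h0 e
      simp only [Pi.add_apply, Pi.smul_apply, smul_eq_mul]
      positivity
    · have hk : ∀ g : G, (N * n : ℤ) • g = 0 := by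
        intro g
        rw [mul_smul, natCast_zsmul g n, card_nsmul_eq_zero, smul_zero]
      simp only [Pi.add_apply, Pi.smul_apply, add_smul, smul_eq_mul, Finset.sum_add_distrib, hl]
      rw [show ∑ e, ((N * n : ℤ) * z e) • γ e = 0 from
        Finset.sum_eq_zero fun e _ => by rw [mul_smul, hk], add_zero]
  have h1 := subset_convexHull ℝ _ hx
  have h2 := subset_convexHull ℝ _ hx2
  have hle : μ / (N * n) ≤ 1 := by
    rw [div_le_one hNpos]
    have : (1 : ℝ) ≤ n := by exact_mod_cast hn
    nlinarith
  have := (convex_convexHull ℝ (Qy s t γ h)).add_smul_mem h1 h2 (t := μ / (N * n))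
    ⟨by positivity, hle⟩
  rwa [smul_smul, div_mul_cancel₀ _ hNpos.ne'] at this

lemma conv_add_cone {q r : E → ℝ} (hq : q ∈ convexHull ℝ (Qy s t γ h)) (hr : Circ s t r)
    (h0 : ∀ e, 0 ≤ r e) : q + r ∈ convexHull ℝ (Qy s t γ h) := by
  refine real_decomp (s := s) (t := t) (fun r => q + r ∈ convexHull ℝ (Qy s t γ h)) (by simpa) ?_ r hr h0
  intro f c μ hf hμ hc h01
  rw [← add_assoc]
  exact conv_add_ray hf rfl hc (fun e => by rcases h01 e with h | h <;> simp [h]) hμ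

/-- homogenization of the convex hull -/
def Hp (s t : E → V) (γ : E → G) (h : G) (μ : ℝ) (y : E → ℝ) : Prop :=
  (μ = 0 ∧ Circ s t y ∧ ∀ e, 0 ≤ y e) ∨ (0 < μ ∧ ∃ q ∈ convexHull ℝ (Qy s t γ h), y = μ • q)

lemma Hp.add_cone {μ : ℝ} {y r : E → ℝ} (hy : Hp s t γ h μ y) (hr : Circ s t r)
    (h0 : ∀ e, 0 ≤ r e) : Hp s t γ h μ (y + r) := by
  rcases hy with ⟨rfl, h1, h2⟩ | ⟨hμ, q, hq, rfl⟩
  · exact Or.inl ⟨rfl, h1.add hr, fun e => add_nonneg (h2 e) (h0 e)⟩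
  · refine Or.inr ⟨hμ, q + μ⁻¹ • r, conv_add_cone hq (hr.smul _) ?_, ?_⟩
    · intro e; have := h0 e; simp only [Pi.smul_apply, smul_eq_mul]; positivity
    · rw [smul_add, smul_smul, mul_inv_cancel₀ hμ.ne', one_smul]

lemma Hp.add {μ μ' : ℝ} {y y' : E → ℝ} (hy : Hp s t γ h μ y) (hy' : Hp s t γ h μ' y') :
    Hp s t γ h (μ + μ') (y + y') := by
  rcases hy' with ⟨rfl, h1, h2⟩ | ⟨hμ', q', hq', rfl⟩
  · rw [add_zero]; exact hy.add_cone h1 h2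
  · rcases hy with ⟨rfl, h1, h2⟩ | ⟨hμ, q, hq, rfl⟩
    · rw [zero_add, add_comm]
      exact Hp.add_cone (Or.inr ⟨hμ', q', hq', rfl⟩) h1 h2
    · refine Or.inr ⟨by positivity, (μ / (μ + μ')) • q + (μ' / (μ + μ')) • q', ?_, ?_⟩
      · exact convex_convexHull ℝ _ hq hq' (by positivity) (by positivity) (by field_simp)
      · rw [smul_add, smul_smul, smul_smul]
        congr 2 <;> field_simp

lemma Hp.zero : Hp s t γ h 0 0 := Or.inl ⟨rfl, Circ.zero, fun _ => le_rfl⟩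

open scoped Pointwise in
lemma Hp.par {h' : G} {μ : ℝ} {y y' : E → ℝ} (hy : Hp s t γ h μ y) (hy' : Hp s t γ h' μ y') :
    Hp s t γ (h + h') μ (y + y') := by
  rcases hy with ⟨rfl, h1, h2⟩ | ⟨hμ, q, hq, rfl⟩
  · rcases hy' with ⟨-, h1', h2'⟩ | ⟨hμ', _⟩
    · exact Or.inl ⟨rfl, h1.add h1', fun e => add_nonneg (h2 e) (h2' e)⟩
    · exact absurd hμ' (lt_irrefl _)
  · rcases hy' with ⟨h0, -⟩ | ⟨-, q', hq', rfl⟩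
    · exact absurd h0 hμ.ne'
    · refine Or.inr ⟨hμ, q + q', ?_, by rw [smul_add]⟩
      have : q + q' ∈ convexHull ℝ (Qy s t γ h + Qy s t γ h') := by
        rw [convexHull_add]; exact Set.add_mem_add hq hq'
      refine convexHull_mono ?_ this
      rintro _ ⟨_, ⟨z, rfl, a1, a2, a3⟩, _, ⟨z', rfl, b1, b2, b3⟩, rfl⟩
      refine ⟨z + z', ?_, fun e => add_nonneg (a1 e) (b1 e), a2.add b2, ?_⟩
      · ext e; simp
      · simp [add_smul, Finset.sum_add_distrib, a3, b3]

lemma Hp.par_zero {μ : ℝ} (hμ : 0 ≤ μ) : Hp s t γ 0 μ 0 := by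
  rcases hμ.eq_or_lt with rfl | hμ
  · exact Hp.zero
  · exact Or.inr ⟨hμ, 0, subset_convexHull ℝ _ ⟨0, by ext; simp, by simp, Circ.zero, by simp⟩, by simp⟩

lemma Hp.par_sum {d : ℕ} (x : Fin d → G) {μ : ℝ} (hμ : 0 ≤ μ) (y : Fin d → E → ℝ)
    (hy : ∀ i, Hp s t γ (x i) μ (y i)) : Hp s t γ (∑ i, x i) μ (∑ i, y i) := by
  induction d with
  | zero => simpa using Hp.par_zero hμ
  | succ d ih =>
    rw [Fin.sum_univ_succ, Fin.sum_univ_succ]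
    exact (hy 0).par (ih _ _ fun i => hy i.succ)

lemma Hp.sum {ι : Type*} (S : Finset ι) (μ : ι → ℝ) (y : ι → E → ℝ)
    (hy : ∀ i ∈ S, Hp s t γ h (μ i) (y i)) : Hp s t γ h (∑ i ∈ S, μ i) (∑ i ∈ S, y i) := by
  classical
  induction S using Finset.induction_on with
  | empty => simpa using Hp.zero
  | insert a S ha ih =>
    rw [Finset.sum_insert ha, Finset.sum_insert ha]
    exact (hy a (by simp)).add (ih fun i hi => hy i (by simp [hi]))

lemma Hp.of_flow {F : Option (E × G) → ℝ} (hF : Circ (lsrc s v h) (ltgt t γ v) F)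
    (h0 : ∀ o, 0 ≤ F o) : Hp s t γ h (F none) (lproj F) := by
  refine real_decomp (s := lsrc s v h) (t := ltgt t γ v)
    (fun F => Hp s t γ h (F none) (lproj F)) ?_ ?_ F hF h0
  · have : lproj (0 : Option (E × G) → ℝ) = 0 := by ext e; simp [lproj]
    rw [this]; exact Hp.zero
  · intro f c μ hf hμ hc h01
    rw [lproj_add, lproj_smul, Pi.add_apply, Pi.smul_apply, smul_eq_mul]
    have hc0 : ∀ o, 0 ≤ c o := fun o => by rcases h01 o with h | h <;> simp [h]
    have hp : lproj (fun e => (c e : ℝ)) = fun e => ((lproj c e : ℤ) : ℝ) := by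
      ext e; simp [lproj]
    have hp0 : ∀ e, 0 ≤ lproj c e := fun e => Finset.sum_nonneg fun _ _ => hc0 _
    refine hf.add ?_
    rcases hμ.eq_or_lt with rfl | hμ
    · rw [zero_mul, zero_smul]; exact Hp.zero
    rcases h01 none with hn | hn
    · refine Or.inl ⟨by simp [hn], Circ.smul _ ?_, ?_⟩
      · rw [hp]; exact circ_cast.2 (lproj_circ hc)
      · intro e; rw [hp]; have : (0 : ℝ) ≤ (lproj c e : ℤ) := by exact_mod_cast hp0 e
        simp only [Pi.smul_apply, smul_eq_mul]; positivity
    · refine Or.inr ⟨by simpa [hn] using hμ, _, subset_convexHull ℝ _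
        ⟨lproj c, hp, hp0, lproj_circ hc, ?_⟩, by simp [hn]⟩
      rw [lproj_label hc, hn, one_smul]

/-- the extended formulation in slack space -/
theorem main_y [Nonempty V] {d : ℕ} (hd : Fintype.card G ≤ d + 1) (g : G) (y : E → ℝ)
    (hy : Circ s t y) :
    y ∈ convexHull ℝ (Qy s t γ g) ↔
      ∃ (μ : {τ : Fin d → V × G // ∑ i, (τ i).2 = g} → ℝ)
        (F : {τ : Fin d → V × G // ∑ i, (τ i).2 = g} → Fin d → Option (E × G) → ℝ),
        (∀ τ i, Circ (lsrc s (τ.1 i).1 (τ.1 i).2) (ltgt t γ (τ.1 i).1) (F τ i) ∧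
          F τ i none = μ τ) ∧
        (∀ τ, 0 ≤ μ τ) ∧ (∀ τ i o, 0 ≤ F τ i (some o)) ∧ ∑ τ, μ τ = 1 ∧
        ∀ e, ∑ τ, ∑ i, lproj (F τ i) e ≤ y e := by
  constructor
  · intro hyc
    clear hy
    set X : Set (E → ℝ) := {y | ∃ (μ : {τ : Fin d → V × G // ∑ i, (τ i).2 = g} → ℝ)
        (F : {τ : Fin d → V × G // ∑ i, (τ i).2 = g} → Fin d → Option (E × G) → ℝ),
        (∀ τ i, Circ (lsrc s (τ.1 i).1 (τ.1 i).2) (ltgt t γ (τ.1 i).1) (F τ i) ∧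
          F τ i none = μ τ) ∧
        (∀ τ, 0 ≤ μ τ) ∧ (∀ τ i o, 0 ≤ F τ i (some o)) ∧ ∑ τ, μ τ = 1 ∧
        ∀ e, ∑ τ, ∑ i, lproj (F τ i) e ≤ y e} with hX
    change y ∈ X
    refine convexHull_min ?_ ?_ hyc
    · rintro _ ⟨z, rfl, h0, hz, hl⟩
      obtain ⟨c, x, hlift, hle, hsum⟩ := good_all (γ := γ) hd hz h0
      choose v F hF0 hF1 hFc hFp using hlift
      set τ0 : {τ : Fin d → V × G // ∑ i, (τ i).2 = g} :=
        ⟨fun i => (v i, x i), by simp only [hsum, hl]⟩ with hτ0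
      refine ⟨fun τ => if τ = τ0 then 1 else 0,
        fun τ i o => if τ = τ0 then (F i o : ℝ) else 0, ?_, ?_, ?_, ?_, ?_⟩
      · intro τ i
        by_cases h : τ = τ0
        · subst h
          simp only [if_true]
          exact ⟨circ_cast.2 (hFc i), by simp [hF1]⟩
        · simp only [h, if_false]
          exact ⟨Circ.zero, trivial⟩
      · intro τ; dsimp only; split_ifs <;> norm_num
      · intro τ i o; dsimp only; split_ifs
        · exact_mod_cast hF0 i _
        · exact le_rfl
      · simp
      · intro e
        have : ∀ i, lproj (fun o => (F i o : ℝ)) e = (c i e : ℝ) := by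
          intro i; rw [← hFp i]; simp [lproj]
        rw [Finset.sum_eq_single τ0]
        · simp only [if_true, this]; exact_mod_cast hle e
        · intro τ _ hne; simp [hne, lproj]
        · simp
    · rintro y ⟨μ, F, h1, h2, h3, h4, h5⟩ y' ⟨μ', F', h1', h2', h3', h4', h5'⟩ a b ha hb hab
      refine ⟨a • μ + b • μ', a • F + b • F', ?_, ?_, ?_, ?_, ?_⟩
      · intro τ i
        exact ⟨((h1 τ i).1.smul a).add ((h1' τ i).1.smul b), by simp [(h1 τ i).2, (h1' τ i).2]⟩
      · intro τ
        have := h2 τ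
        have := h2' τ
        simp only [Pi.add_apply, Pi.smul_apply, smul_eq_mul]; positivity
      · intro τ i o
        have := h3 τ i o
        have := h3' τ i o
        simp only [Pi.add_apply, Pi.smul_apply, smul_eq_mul]; positivity
      · simp only [Pi.add_apply, Pi.smul_apply, smul_eq_mul, Finset.sum_add_distrib,
          ← Finset.mul_sum, h4, h4']; linarith
      · intro e
        simp only [Pi.add_apply, Pi.smul_apply, lproj_add, lproj_smul, smul_eq_mul,
          Finset.sum_add_distrib, ← Finset.mul_sum]
        exact add_le_add (mul_le_mul_of_nonneg_left (h5 e) ha) (mul_le_mul_of_nonneg_left (h5' e) hb)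
  · rintro ⟨μ, F, h1, h2, h3, h4, h5⟩
    have hF0 : ∀ τ i o, 0 ≤ F τ i o := by
      rintro τ i (_ | o)
      · rw [(h1 τ i).2]; exact h2 τ
      · exact h3 τ i o
    have hτ : ∀ τ, Hp s t γ g (μ τ) (∑ i, lproj (F τ i)) := by
      intro τ
      have := Hp.par_sum (s := s) (t := t) (γ := γ) (fun i => (τ.1 i).2) (h2 τ)
        (fun i => lproj (F τ i))
        (fun i => by rw [← (h1 τ i).2]; exact Hp.of_flow (h1 τ i).1 (hF0 τ i))
      rwa [τ.2] at this
    have htot := Hp.sum Finset.univ μ (fun τ => ∑ i, lproj (F τ i)) (fun τ _ => hτ τ)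
    rw [h4] at htot
    have hc : Circ s t (∑ τ, ∑ i, lproj (F τ i)) :=
      Circ.sum _ fun τ _ => Circ.sum _ fun i _ => lproj_circ (h1 τ i).1
    have hfin := htot.add_cone (hy.sub hc) (fun e => by
      have := h5 e
      simp only [Pi.sub_apply, Finset.sum_apply]; linarith)
    rw [add_sub_cancel] at hfin
    rcases hfin with ⟨h, -⟩ | ⟨-, q, hq, rfl⟩
    · norm_num at h
    · rwa [one_smul]
end lift
lemma hasEF_of {n : ℕ} {J W : Type*} [Fintype J] [AddCommGroup W] [Module ℝ W] [FiniteDimensional ℝ W]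
    (U : Submodule ℝ W) (B : J → (Fin n → ℝ) → ℝ) (hB : ∀ j, IsLinearMap ℝ (B j))
    (C : J → W → ℝ) (hC : ∀ j, IsLinearMap ℝ (C j)) (d : J → ℝ) :
    HasEF {x | ∃ u ∈ U, ∀ j, B j x + C j u ≤ d j} (Fintype.card J) := by
  let e := (Fintype.equivFin J).symm
  let φ := (Module.finBasis ℝ U).equivFun
  let B' : (Fin n → ℝ) →ₗ[ℝ] (Fin (Fintype.card J) → ℝ) :=
    LinearMap.pi fun i => (hB (e i)).mk' _
  let C' : (Fin (Module.finrank ℝ U) → ℝ) →ₗ[ℝ] (Fin (Fintype.card J) → ℝ) :=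
    LinearMap.pi fun i => ((hC (e i)).mk' _) ∘ₗ U.subtype ∘ₗ φ.symm.toLinearMap
  refine ⟨_, LinearMap.toMatrix' B', LinearMap.toMatrix' C', d ∘ e, ?_⟩
  ext x
  simp only [Set.mem_setOf_eq, LinearMap.toMatrix'_mulVec]
  constructor
  · rintro ⟨u, hu, h⟩
    refine ⟨φ ⟨u, hu⟩, fun i => ?_⟩
    have := h (e i)
    simpa [B', C'] using! this
  · rintro ⟨y, h⟩
    refine ⟨(φ.symm y).1, (φ.symm y).2, fun j => ?_⟩
    have := h (e.symm j)
    simpa [B', C'] using! this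

lemma card_quot {n : ℕ} (B : Matrix (Fin n) (Fin n) ℤ) (hB : B.det ≠ 0) :
    Nat.card ((Fin n → ℤ) ⧸ LinearMap.range B.mulVecLin) = B.det.natAbs := by
  have hinj : Function.Injective B.mulVecLin := by
    rw [← LinearMap.ker_eq_bot, LinearMap.ker_eq_bot']
    intro x hx
    exact Matrix.eq_zero_of_mulVec_eq_zero hB hx
  rw [← Submodule.natAbs_det_equiv _ (LinearEquiv.ofInjective B.mulVecLin hinj)]
  congr 1
  rw [← LinearMap.det_toLin' B]
  congr 1

lemma exists_minor {m n : ℕ} (A : Matrix (Fin m) (Fin n) ℤ)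
    (h : (A.map (Int.cast : ℤ → ℝ)).rank = n) : ∃ f : Fin n → Fin m, (A.submatrix f id).det ≠ 0 := by
  set M := A.map (Int.cast : ℤ → ℝ)
  obtain ⟨κ, a, ha, hspan, hli⟩ := exists_linearIndependent' ℝ M.row
  have : Fintype κ := Fintype.ofInjective a ha
  have hc : Fintype.card κ = n := by
    rw [← h, Matrix.rank_eq_finrank_span_row, ← hspan, finrank_span_eq_card hli]
  let e : Fin n ≃ κ := (Fintype.equivFinOfCardEq hc).symm
  refine ⟨a ∘ e, fun hdet => ?_⟩
  have hli2 : LinearIndependent ℝ (M.submatrix (a ∘ e) id).row := hli.comp e e.injective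
  rw [Matrix.linearIndependent_rows_iff_isUnit, Matrix.isUnit_iff_isUnit_det] at hli2
  have h2 : (M.submatrix (a ∘ e) id).det = (((A.submatrix (a ∘ e) id).det : ℤ) : ℝ) := by
    have := (Int.castRingHom ℝ).map_det (A.submatrix (a ∘ e) id)
    simp only [eq_intCast] at this
    rw [this]; rfl
  rw [h2, hdet] at hli2
  simp at hli2

lemma final_aux {d m n : ℕ} (A : Matrix (Fin m) (Fin n) ℤ) (b : Fin m → ℤ) (f : Fin n → Fin m)
    (hdet : (A.submatrix f id).det.natAbs = d + 1)
    (hb : ∃ x : Fin n → ℝ, (A.map (Int.cast : ℤ → ℝ)).mulVec x = fun i => (b i : ℝ))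
    {V : Type} [Fintype V] [DecidableEq V] [Nonempty V] (s t : Fin m → V)
    (hD : ∀ y : Fin m → ℝ, Circ s t y ↔ ∃ x : Fin n → ℝ, (A.map (Int.cast : ℤ → ℝ)).mulVec x = y) :
    ∃ ℓ ≤ m + ((Fintype.card V * (d + 1)) ^ d * (d * (m * (d + 1))) +
      ((Fintype.card V * (d + 1)) ^ d + 2)),
      HasEF (convexHull ℝ {x ∈ Pset A b | IsIntVec x}) ℓ := by
  classical
  set B := A.submatrix f id with hBdef
  have hB0 : B.det ≠ 0 := by intro h; simp [h] at hdet
  let G := (Fin n → ℤ) ⧸ LinearMap.range B.mulVecLin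
  have hcard : Nat.card G = d + 1 := (card_quot B hB0).trans hdet
  haveI : Finite G := Nat.finite_of_card_ne_zero (by omega)
  letI : Fintype G := Fintype.ofFinite G
  have hcard' : Fintype.card G = d + 1 := by rw [← Nat.card_eq_fintype_card, hcard]
  let π : (Fin n → ℤ) →ₗ[ℤ] G := Submodule.mkQ _
  let γ : Fin m → G := fun a => ∑ i, if f i = a then π (Pi.single i 1) else 0
  have hγ : ∀ z : Fin m → ℤ, ∑ a, z a • γ a = π (z ∘ f) := by
    intro z
    simp only [γ, Finset.smul_sum, smul_ite, smul_zero]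
    rw [Finset.sum_comm]
    simp only [Finset.sum_ite_eq, Finset.mem_univ, if_true, ← map_smul, ← map_sum]
    congr 1
    ext j
    simp [Finset.sum_apply, Pi.single_apply]
  set g : G := π (b ∘ f) with hg
  set Ar := A.map (Int.cast : ℤ → ℝ) with hAr
  have hBr : ∀ x : Fin n → ℝ, (∀ i, Ar.mulVec x (f i) = 0) → x = 0 := by
    intro x hx
    have h2 : (B.map (Int.cast : ℤ → ℝ)).det = ((B.det : ℤ) : ℝ) := by
      have := (Int.castRingHom ℝ).map_det B
      simp only [eq_intCast] at this
      rw [this]; rfl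
    refine Matrix.eq_zero_of_mulVec_eq_zero (M := B.map (Int.cast : ℤ → ℝ)) ?_ ?_
    · rw [h2]; exact_mod_cast hB0
    · ext i; exact hx i
  have hcastmul : ∀ z : Fin n → ℤ, Ar.mulVec (fun i => (z i : ℝ)) = fun a => ((A.mulVec z a : ℤ) : ℝ) := by
    intro z; ext a
    simp [Matrix.mulVec, dotProduct, hAr]
  -- the slack map
  let Φ : (Fin n → ℝ) →ᵃ[ℝ] (Fin m → ℝ) :=
    AffineMap.const ℝ _ (fun a => (b a : ℝ)) - (Ar.mulVecLin).toAffineMap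
  have hΦ : ∀ x, Φ x = (fun a => (b a : ℝ)) - Ar.mulVec x := fun x => by simp [Φ]
  have hΦinj : Function.Injective Φ := by
    intro x y hxy
    rw [hΦ, hΦ, sub_right_inj] at hxy
    refine sub_eq_zero.1 (hBr (x - y) fun i => ?_)
    rw [Matrix.mulVec_sub, hxy, sub_self]; rfl
  have hbc : Circ s t (fun a => (b a : ℝ)) := (hD _).2 hb
  have hΦc : ∀ x, Circ s t (Φ x) := fun x => by rw [hΦ]; exact hbc.sub ((hD _).2 ⟨x, rfl⟩)
  have himg : Φ '' {x ∈ Pset A b | IsIntVec x} = Qy s t γ g := by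
    ext y
    constructor
    · rintro ⟨x, ⟨hx, hint⟩, rfl⟩
      choose z hz using hint
      have hxz : x = fun i => (z i : ℝ) := funext hz
      have hval : Φ x = fun a => ((b a - A.mulVec z a : ℤ) : ℝ) := by
        rw [hΦ, hxz, hcastmul]; ext a; simp
      refine ⟨fun a => b a - A.mulVec z a, hval, ?_, ?_, ?_⟩
      · intro a
        have h1 : Ar.mulVec x a ≤ b a := hx a
        rw [hxz, hcastmul] at h1
        dsimp only at h1
        have h2 : A.mulVec z a ≤ b a := by exact_mod_cast h1
        show 0 ≤ b a - A.mulVec z a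
        omega
      · rw [← circ_cast, ← hval]; exact hΦc x
      · rw [hγ, hg, ← sub_eq_zero, ← map_sub]
        refine (Submodule.Quotient.mk_eq_zero _).2 ⟨-z, ?_⟩
        ext i
        simp [Matrix.mulVec_neg, hBdef]
        rfl
    · rintro ⟨w, rfl, hw0, hwc, hl⟩
      rw [hγ, hg, ← sub_eq_zero, ← map_sub] at hl
      obtain ⟨z, hz⟩ := (Submodule.Quotient.mk_eq_zero _).1 hl
      obtain ⟨x, hx⟩ := (hD _).1 (hbc.sub (circ_cast.2 hwc))
      have hxz : x = fun i => ((-z i : ℤ) : ℝ) := by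
        refine sub_eq_zero.1 (hBr _ fun i => ?_)
        rw [Matrix.mulVec_sub, hx, hcastmul]
        have h1 : A.mulVec z (f i) = w (f i) - b (f i) := congrFun hz i
        have h2 : A.mulVec (fun i => - z i) = - A.mulVec z := Matrix.mulVec_neg z A
        simp only [Pi.sub_apply, h2, Pi.neg_apply, h1]
        push_cast; ring
      refine ⟨x, ⟨?_, fun i => ⟨_, congrFun hxz i⟩⟩, ?_⟩
      · intro a
        have h1 := congrFun hx a
        have h2 : (0 : ℝ) ≤ w a := by exact_mod_cast hw0 a
        simp only [Pi.sub_apply] at h1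
        show Ar.mulVec x a ≤ b a
        linarith
      · rw [hΦ, hx]; ext a; simp
  have hmem : ∀ x, x ∈ convexHull ℝ {x ∈ Pset A b | IsIntVec x} ↔
      Φ x ∈ convexHull ℝ (Qy s t γ g) := by
    intro x
    rw [← himg, ← AffineMap.image_convexHull, hΦinj.mem_set_image]
  let T := {τ : Fin d → V × G // ∑ i, (τ i).2 = g}
  let U : Submodule ℝ ((T → ℝ) × (T → Fin d → Option (Fin m × G) → ℝ)) :=
    { carrier := {u | ∀ (τ : T) (i : Fin d), Circ (lsrc s (τ.1 i).1 (τ.1 i).2) (ltgt t γ (τ.1 i).1) (u.2 τ i) ∧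
          u.2 τ i none = u.1 τ}
      zero_mem' := fun τ i => ⟨Circ.zero, rfl⟩
      add_mem' := fun {u v} hu hv τ i => ⟨(hu τ i).1.add (hv τ i).1, by
        simp [(hu τ i).2, (hv τ i).2]⟩
      smul_mem' := fun c u hu τ i => ⟨(hu τ i).1.smul c, by simp [(hu τ i).2]⟩ }
  let J := Fin m ⊕ ((T × (Fin d × (Fin m × G))) ⊕ (T ⊕ Bool))
  let Bf : J → (Fin n → ℝ) → ℝ := fun j x => match j with
    | Sum.inl a => Ar.mulVec x a
    | Sum.inr _ => 0
  let Cf : J → ((T → ℝ) × (T → Fin d → Option (Fin m × G) → ℝ)) → ℝ := fun j u => match j with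
    | Sum.inl a => ∑ τ, ∑ i, lproj (u.2 τ i) a
    | Sum.inr (Sum.inl p) => - u.2 p.1 p.2.1 (some p.2.2)
    | Sum.inr (Sum.inr (Sum.inl τ)) => - u.1 τ
    | Sum.inr (Sum.inr (Sum.inr true)) => ∑ τ, u.1 τ
    | Sum.inr (Sum.inr (Sum.inr false)) => - ∑ τ, u.1 τ
  let df : J → ℝ := fun j => match j with
    | Sum.inl a => b a
    | Sum.inr (Sum.inl _) => 0
    | Sum.inr (Sum.inr (Sum.inl _)) => 0
    | Sum.inr (Sum.inr (Sum.inr true)) => 1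
    | Sum.inr (Sum.inr (Sum.inr false)) => -1
  have hBf : ∀ j, IsLinearMap ℝ (Bf j) := by
    rintro (a | _)
    · exact ⟨fun x y => by simp [Bf, Matrix.mulVec_add], fun c x => by simp [Bf, Matrix.mulVec_smul]⟩
    · exact ⟨fun x y => by simp [Bf], fun c x => by simp [Bf]⟩
  have hCf : ∀ j, IsLinearMap ℝ (Cf j) := by
    rintro (a | p | τ | (_ | _))
    · exact ⟨fun x y => by simp [Cf, lproj_add, Finset.sum_add_distrib],
        fun c x => by simp [Cf, lproj_smul, Finset.mul_sum]⟩
    · exact ⟨fun x y => by simp [Cf]; ring, fun c x => by simp [Cf]⟩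
    · exact ⟨fun x y => by simp [Cf]; ring, fun c x => by simp [Cf]⟩
    · exact ⟨fun x y => by simp [Cf, Finset.sum_add_distrib]; ring,
        fun c x => by simp [Cf, Finset.mul_sum]⟩
    · exact ⟨fun x y => by simp [Cf, Finset.sum_add_distrib],
        fun c x => by simp [Cf, Finset.mul_sum]⟩
  have key := hasEF_of U Bf hBf Cf hCf df
  refine ⟨Fintype.card J, ?_, ?_⟩
  · have hT : Fintype.card T ≤ (Fintype.card V * (d + 1)) ^ d := by
      refine (Fintype.card_subtype_le _).trans ?_
      simp [Fintype.card_pi, hcard']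
    simp only [J, Fintype.card_sum, Fintype.card_prod, Fintype.card_fin, Fintype.card_bool, hcard']
    gcongr
  · convert key using 1
    ext x
    rw [hmem, main_y (d := d) hcard'.le g _ (hΦc x)]
    simp only [Set.mem_setOf_eq]
    constructor
    · rintro ⟨μ, F, h1, h2, h3, h4, h5⟩
      refine ⟨(μ, F), h1, ?_⟩
      rintro (a | p | τ | (_ | _))
      · have := h5 a
        rw [hΦ] at this
        simp only [Pi.sub_apply] at this
        simp only [Bf, Cf, df]; linarith
      · have := h3 p.1 p.2.1 p.2.2
        simp only [Bf, Cf, df]; linarith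
      · have := h2 τ
        simp only [Bf, Cf, df]; linarith
      · simp only [Bf, Cf, df]; exact le_of_eq (by rw [zero_add]; exact congrArg _ h4)
      · simp only [Bf, Cf, df]; exact le_of_eq (by rw [zero_add]; exact h4)
    · rintro ⟨⟨μ, F⟩, h1, h⟩
      refine ⟨μ, F, h1, ?_, ?_, ?_, ?_⟩
      · intro τ
        have := h (Sum.inr (Sum.inr (Sum.inl τ)))
        simp only [Bf, Cf, df] at this; linarith
      · intro τ i o
        have := h (Sum.inr (Sum.inl (τ, i, o)))
        simp only [Bf, Cf, df] at this; linarith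
      · have e1 := h (Sum.inr (Sum.inr (Sum.inr true)))
        have e2 := h (Sum.inr (Sum.inr (Sum.inr false)))
        simp only [Bf, Cf, df] at e1 e2
        exact le_antisymm (by linarith) (by linarith)
      · intro a
        have := h (Sum.inl a)
        simp only [Bf, Cf, df] at this
        rw [hΦ]
        simp only [Pi.sub_apply]; linarith

theorem stmt9 (Δ : ℕ) :
    ∃ c : ℕ, ∀ (m n : ℕ) (A : Matrix (Fin m) (Fin n) ℤ) (b : Fin m → ℤ),
      (A.map (Int.cast : ℤ → ℝ)).rank = n →
      (∀ f : Fin n → Fin m,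
        (A.submatrix f id).det = 0 ∨ (A.submatrix f id).det = (Δ : ℤ) ∨
          (A.submatrix f id).det = -(Δ : ℤ)) →
      (∃ x : Fin n → ℝ, (A.map (Int.cast : ℤ → ℝ)).mulVec x = fun i => (b i : ℝ)) →
      ∀ (V : Type) [Fintype V] [DecidableEq V] (s t : Fin m → V),
        (∀ a, s a ≠ t a) →
        ∀ (D : Matrix V (Fin m) ℤ),
        (∀ v a, D v a = (if v = s a then 1 else 0) - (if v = t a then 1 else 0)) →
        ({y : Fin m → ℝ | (D.map (Int.cast : ℤ → ℝ)).mulVec y = 0} =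
          {y : Fin m → ℝ | ∃ x : Fin n → ℝ, (A.map (Int.cast : ℤ → ℝ)).mulVec x = y}) →
        ∃ ℓ ≤ c * m * Fintype.card V ^ (Δ - 1),
          HasEF (convexHull ℝ {x ∈ Pset A b | IsIntVec x}) ℓ := by
  refine ⟨1 + (Δ - 1 + 1) ^ (Δ - 1) * ((Δ - 1) * (Δ - 1 + 1)) + (Δ - 1 + 1) ^ (Δ - 1) + 2, ?_⟩
  intro m n A b hrank hmod hb V _ _ s t hst D hD hker
  rcases Nat.eq_zero_or_pos m with rfl | hm
  · have hn : n = 0 := by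
      have := Matrix.rank_le_height (A.map (Int.cast : ℤ → ℝ))
      omega
    subst hn
    refine ⟨0, Nat.zero_le _, 0, 0, 0, 0, ?_⟩
    ext x
    simp only [Set.mem_setOf_eq]
    constructor
    · intro _; exact ⟨0, fun i => i.elim0⟩
    · intro _
      exact subset_convexHull ℝ _ ⟨fun i => i.elim0, fun i => i.elim0⟩
  · obtain ⟨f, hf⟩ := exists_minor A hrank
    haveI : Nonempty V := ⟨s ⟨0, hm⟩⟩
    have hdet : (A.submatrix f id).det.natAbs = Δ := by
      rcases hmod f with h | h | h
      · exact absurd h hf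
      · rw [h]; simp
      · rw [h]; simp
    have hΔ : Δ - 1 + 1 = Δ := by
      have : (A.submatrix f id).det.natAbs ≠ 0 := Int.natAbs_ne_zero.2 hf
      omega
    obtain ⟨ℓ, hℓ, hEF⟩ := final_aux (d := Δ - 1) A b f (by rw [hdet, hΔ]) hb s t (by
      intro y
      have h1 : Circ s t y ↔ y ∈ {y : Fin m → ℝ | (D.map (Int.cast : ℤ → ℝ)).mulVec y = 0} := by
        simp only [Set.mem_setOf_eq, funext_iff]
        refine forall_congr' fun w => ?_
        simp only [Matrix.mulVec, dotProduct, Matrix.map_apply, hD, Pi.zero_apply]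
        push_cast
        simp only [mul_comm]
      rw [h1, hker]; rfl)
    refine ⟨ℓ, hℓ.trans ?_, hEF⟩
    have hV : 1 ≤ Fintype.card V ^ (Δ - 1) := Nat.one_le_pow _ _ Fintype.card_pos
    rw [mul_pow]
    generalize Fintype.card V ^ (Δ - 1) = X at *
    generalize (Δ - 1 + 1) ^ (Δ - 1) = Y at *
    generalize (Δ - 1) = k at *
    have a1 : m * 1 ≤ m * X := Nat.mul_le_mul_left _ hV
    have a2 : 1 * (X * Y) ≤ m * (X * Y) := Nat.mul_le_mul_right _ hm
    have a3 : 1 * 1 ≤ m * X := Nat.mul_le_mul hm hV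
    nlinarith
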